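/- Hyperbolic velocity turnpike bound for the double integrator: for every real T > 0, every t ∈ [0, T], and every real q̃, one has |q̃·(sinh(t) + sinh(T − t) − sinh(T))/(2·(cosh(T) − 1) − T·sinh(T))| ≤ (3·|q̃|/2)/T; i.e., the optimal velocity v* of the double-integrator optimal control problem with v₀ = v_T = 0 satisfies |v*(t)| ≤ C_{q̃}/T for all t ∈ [0, T] with C_{q̃} = 3·|q̃|/2. -/

import Mathlib

theorem nonneg_of_hasDerivAt_nonneg {f f' : ℝ → ℝ} (hf : ∀ x, HasDerivAt f (f' x) x)
    (h0 : f 0 = 0) (hf' : ∀ x, 0 ≤ x → 0 ≤ f' x) {x : ℝ} (hx : 0 ≤ x) : 0 ≤ f x := by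
  have hmono : MonotoneOn f (Set.Ici 0) := by
    refine monotoneOn_of_hasDerivWithinAt_nonneg (convex_Ici 0)
      (fun y _ => (hf y).continuousAt.continuousWithinAt)
      (fun y _ => (hf y).hasDerivWithinAt) (fun y hy => hf' y ?_)
    exact interior_subset hy
  simpa [h0] using hmono (Set.mem_Ici.2 le_rfl) (Set.mem_Ici.2 hx) hx

theorem sinh_le_mul_cosh {x : ℝ} (hx : 0 ≤ x) : Real.sinh x ≤ x * Real.cosh x := by
  have hderiv (y : ℝ) : HasDerivAt (fun y => y * Real.cosh y - Real.sinh y)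
      (y * Real.sinh y) y :=
    (((hasDerivAt_id' y).mul (Real.hasDerivAt_cosh y)).sub
      (Real.hasDerivAt_sinh y)).congr_deriv (by ring)
  exact sub_nonneg.1 (nonneg_of_hasDerivAt_nonneg hderiv (by simp)
    (fun y hy => mul_nonneg hy (Real.sinh_nonneg_iff.2 hy)) hx)

theorem two_mul_cosh_sub_one_le_mul_sinh {x : ℝ} (hx : 0 ≤ x) :
    2 * (Real.cosh x - 1) ≤ x * Real.sinh x := by
  have hderiv (y : ℝ) : HasDerivAt (fun y => y * Real.sinh y - 2 * (Real.cosh y - 1))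
      (y * Real.cosh y - Real.sinh y) y :=
    (((hasDerivAt_id' y).mul (Real.hasDerivAt_sinh y)).sub
      (((Real.hasDerivAt_cosh y).sub_const 1).const_mul 2)).congr_deriv (by ring)
  exact sub_nonneg.1 (nonneg_of_hasDerivAt_nonneg hderiv (by simp)
    (fun y hy => sub_nonneg.2 (sinh_le_mul_cosh hy)) hx)

/-- The hyperbolic Cusa-Huygens inequality. -/
theorem three_mul_sinh_le_mul_cosh_add_two {x : ℝ} (hx : 0 ≤ x) :
    3 * Real.sinh x ≤ x * (Real.cosh x + 2) := by
  have hderiv (y : ℝ) : HasDerivAt (fun y => y * (Real.cosh y + 2) - 3 * Real.sinh y)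
      (y * Real.sinh y - 2 * (Real.cosh y - 1)) y :=
    (((hasDerivAt_id' y).mul ((Real.hasDerivAt_cosh y).add_const 2)).sub
      ((Real.hasDerivAt_sinh y).const_mul 3)).congr_deriv (by ring)
  exact sub_nonneg.1 (nonneg_of_hasDerivAt_nonneg hderiv (by simp)
    (fun y hy => sub_nonneg.2 (two_mul_cosh_sub_one_le_mul_sinh hy)) hx)

/-- Hyperbolic velocity turnpike bound for the double integrator: for every
`T > 0`, `t ∈ [0, T]` and `q̃ : ℝ`, the optimal velocity
`v*(t) = q̃ (sinh t + sinh (T - t) - sinh T) / (2 (cosh T - 1) - T sinh T)`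
satisfies `|v*(t)| ≤ (3 |q̃| / 2) / T`. -/
theorem hyperbolic_velocity_turnpike_bound (T : ℝ) (hT : 0 < T)
    (t : ℝ) (ht : t ∈ Set.Icc 0 T) (qtilde : ℝ) :
    |qtilde * (Real.sinh t + Real.sinh (T - t) - Real.sinh T) /
        (2 * (Real.cosh T - 1) - T * Real.sinh T)| ≤ (3 * |qtilde| / 2) / T := by
  obtain ⟨ht0, htT⟩ := ht
  obtain ⟨a, rfl⟩ : ∃ a, T = 2 * a := ⟨T / 2, by ring⟩
  obtain ⟨s, rfl⟩ : ∃ s, t = a + s := ⟨t - a, by ring⟩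
  have ha : 0 < a := by linarith
  have hsa : Real.cosh s ≤ Real.cosh a := by
    rw [Real.cosh_le_cosh, abs_of_pos ha, abs_le]
    constructor <;> linarith
  have hsinh : 0 < Real.sinh a := Real.sinh_pos_iff.2 ha
  have hnum : Real.sinh (a + s) + Real.sinh (2 * a - (a + s)) - Real.sinh (2 * a) =
      -(2 * Real.sinh a * (Real.cosh a - Real.cosh s)) := by
    rw [show 2 * a - (a + s) = a - s by ring, Real.sinh_add, Real.sinh_sub, Real.sinh_two_mul]
    ring
  have hden : 2 * (Real.cosh (2 * a) - 1) - 2 * a * Real.sinh (2 * a) =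
      -(4 * Real.sinh a * (a * Real.cosh a - Real.sinh a)) := by
    rw [Real.cosh_two_mul, Real.sinh_two_mul, Real.cosh_sq]
    ring
  have hcosh : 0 ≤ Real.cosh a - Real.cosh s := sub_nonneg.2 hsa
  have hpos : 0 ≤ a * Real.cosh a - Real.sinh a := sub_nonneg.2 (sinh_le_mul_cosh ha.le)
  have hmain : 2 * a * (Real.cosh a - Real.cosh s) ≤
      3 * (a * Real.cosh a - Real.sinh a) := by
    have := mul_le_mul_of_nonneg_left (Real.one_le_cosh s) ha.le
    linarith [three_mul_sinh_le_mul_cosh_add_two ha.le]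
  rw [hnum, hden, abs_div, abs_mul, abs_neg, abs_neg,
    abs_of_nonneg (mul_nonneg (by positivity) hcosh),
    abs_of_nonneg (mul_nonneg (by positivity) hpos)]
  refine div_le_of_le_mul₀ (mul_nonneg (by positivity) hpos) (by positivity) ?_
  rw [div_mul_eq_mul_div, le_div_iff₀ (by positivity)]
  linarith [mul_le_mul_of_nonneg_left hmain
    (by positivity : 0 ≤ 2 * |qtilde| * Real.sinh a)]
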